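/- For all n, k, r, the Monte Carlo methods Â_{n,k,r} on the sign-valued class and Ā_{n,k,r} on the full monotone class have equal worst-case expected errors: sup_{f∈F_mon±^d} E‖Â_{n,k,r}(f) − f‖_{L1} = sup_{f∈F_mon^d} E‖Ā_{n,k,r}(f) − f‖_{L1}. -/

import Mathlib

open MeasureTheory
open scoped ENNReal NNReal

noncomputable section

/-- The unit cube `[0,1]^d`. -/
def unitCube (d : ℕ) : Set (Fin d → ℝ) := Set.Icc 0 1

/-- The class of monotone functions `f : [0,1]^d → [-1,1]`. -/
def FMon (d : ℕ) : Set ((Fin d → ℝ) → ℝ) :=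
  {f | (∀ x ∈ unitCube d, f x ∈ Set.Icc (-1 : ℝ) 1) ∧
       (∀ x ∈ unitCube d, ∀ y ∈ unitCube d, x ≤ y → f x ≤ f y)}

/-- The class of sign-valued monotone functions `f : [0,1]^d → {-1,+1}`. -/
def FMonPM (d : ℕ) : Set ((Fin d → ℝ) → ℝ) :=
  {f | f ∈ FMon d ∧ ∀ x ∈ unitCube d, f x = -1 ∨ f x = 1}

/-- The (extended-real-valued) `L₁([0,1]^d)` distance between two functions. -/
def dist1e {d : ℕ} (g f : (Fin d → ℝ) → ℝ) : ℝ≥0∞ :=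
  ∫⁻ x in unitCube d, ENNReal.ofReal |g x - f x|

/-- The dyadic interval `I_{λ,κ} = [κ2^{-λ}, (κ+1)2^{-λ})`, closed at the right end
for the last one (`κ = 2^λ - 1`). -/
def dyadicI (lam kap : ℕ) : Set ℝ :=
  if kap + 1 = 2 ^ lam then Set.Icc ((kap : ℝ) / 2 ^ lam) 1
  else Set.Ico ((kap : ℝ) / 2 ^ lam) (((kap : ℝ) + 1) / 2 ^ lam)

/-- One-dimensional Haar functions: `ψ₀ = 1_{[0,1]}` and, for `α = 2^λ + κ ≥ 1`,
`ψ_α = 2^{λ/2}(1_{I_{λ+1,2κ+1}} - 1_{I_{λ+1,2κ}})`. -/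
def haar1 (α : ℕ) : ℝ → ℝ :=
  if α = 0 then (Set.Icc (0 : ℝ) 1).indicator 1
  else fun x =>
    Real.sqrt (2 ^ Nat.log 2 α) *
      ((dyadicI (Nat.log 2 α + 1) (2 * (α - 2 ^ Nat.log 2 α) + 1)).indicator 1 x -
        (dyadicI (Nat.log 2 α + 1) (2 * (α - 2 ^ Nat.log 2 α))).indicator 1 x)

/-- The tensor-product Haar function `ψ_α(x) = ∏_j ψ_{α_j}(x_j)`. -/
def haar {d : ℕ} (α : Fin d → ℕ) (x : Fin d → ℝ) : ℝ :=
  ∏ j, haar1 (α j) (x j)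

/-- The Haar wavelet coefficient `f̃(α) = ⟨ψ_α, f⟩`. -/
def wcoef {d : ℕ} (f : (Fin d → ℝ) → ℝ) (α : Fin d → ℕ) : ℝ :=
  ∫ x in unitCube d, haar α x * f x

/-- The number of active variables `|α|₀ = #{j : α_j > 0}`. -/
def activeCount {d : ℕ} (α : Fin d → ℕ) : ℕ :=
  (Finset.univ.filter (fun j => α j ≠ 0)).card

/-- The sign function, with the convention `sgn 0 = 1`. -/
def sgn (t : ℝ) : ℝ := if 0 ≤ t then 1 else -1

/-- The truncated Haar expansion `f_r = Σ_{α : λ(α) < r} f̃(α) ψ_α`; the indices `α ∈ ℕ₀`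
of level `< r` are exactly those with `α < 2^r`. -/
def truncExp {d : ℕ} (f : (Fin d → ℝ) → ℝ) (r : ℕ) : (Fin d → ℝ) → ℝ :=
  fun x => ∑ α : Fin d → Fin (2 ^ r),
    wcoef f (fun j => (α j : ℕ)) * haar (fun j => (α j : ℕ)) x

/-- The distribution of `n` i.i.d. points uniformly distributed on `[0,1]^d`. -/
def sampleMeasure (d n : ℕ) : Measure (Fin n → (Fin d → ℝ)) :=
  Measure.pi (fun _ => volume.restrict (unitCube d))

/-- The linear reconstruction `A_{n,k,r}`: all Haar coefficients with at most `k` active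
variables and level `< r` are estimated by standard Monte Carlo from the samples
`ξ_1, …, ξ_n`. -/
def linAlg (d n k r : ℕ) (ξ : Fin n → (Fin d → ℝ)) (f : (Fin d → ℝ) → ℝ) :
    (Fin d → ℝ) → ℝ :=
  fun x => ∑ α ∈ Finset.univ.filter
      (fun α : Fin d → Fin (2 ^ r) => activeCount (fun j => (α j : ℕ)) ≤ k),
    ((n : ℝ)⁻¹ * ∑ i, haar (fun j => (α j : ℕ)) (ξ i) * f (ξ i)) *
      haar (fun j => (α j : ℕ)) x

/-- The sign-valued reconstruction `Â_{n,k,r} = sgn ∘ A_{n,k,r}`. -/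
def hatAlg (d n k r : ℕ) (ξ : Fin n → (Fin d → ℝ)) (f : (Fin d → ℝ) → ℝ) :
    (Fin d → ℝ) → ℝ :=
  fun x => sgn (linAlg d n k r ξ f x)

/-- The general method `Ā_{n,k,r}(f) = (1/2)∫_{-1}^{1} Â_{n,k,r}(f_t) dt`, where
`f_t = sgn(f - t)`. -/
def barAlg (d n k r : ℕ) (ξ : Fin n → (Fin d → ℝ)) (f : (Fin d → ℝ) → ℝ) :
    (Fin d → ℝ) → ℝ :=
  fun x => (1 / 2) * ∫ t in (-1 : ℝ)..1, hatAlg d n k r ξ (fun y => sgn (f y - t)) x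

lemma abs_sgn_le_one (t : ℝ) : |sgn t| ≤ 1 := by
  unfold sgn; split_ifs <;> simp

@[fun_prop]
lemma measurable_sgn : Measurable sgn :=
  Measurable.ite measurableSet_Ici measurable_const measurable_const

lemma measurableSet_dyadicI (l κ : ℕ) : MeasurableSet (dyadicI l κ) := by
  unfold dyadicI
  split_ifs
  · exact measurableSet_Icc
  · exact measurableSet_Ico

@[fun_prop]
lemma measurable_haar1 (α : ℕ) : Measurable (haar1 α) := by
  unfold haar1
  split_ifs
  · exact measurable_one.indicator measurableSet_Icc
  · exact measurable_const.mul ((measurable_one.indicator (measurableSet_dyadicI _ _)).sub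
      (measurable_one.indicator (measurableSet_dyadicI _ _)))

@[fun_prop]
lemma measurable_haar {d : ℕ} (α : Fin d → ℕ) : Measurable (haar α) := by
  unfold haar
  fun_prop

lemma measurableSet_unitCube (d : ℕ) : MeasurableSet (unitCube d) :=
  measurableSet_Icc

/-- The reconstruction only depends on the sampled values of the input function. -/
lemma hatAlg_congr {d n k r : ℕ} {ξ : Fin n → (Fin d → ℝ)} {f g : (Fin d → ℝ) → ℝ}
    (h : ∀ i, f (ξ i) = g (ξ i)) : hatAlg d n k r ξ f = hatAlg d n k r ξ g := by
  funext x
  simp only [hatAlg, linAlg, h]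

lemma measurable_hatAlg_threshold (d n k r : ℕ) {g : (Fin d → ℝ) → ℝ} (hg : Measurable g) :
    Measurable fun p : ℝ × (Fin n → (Fin d → ℝ)) × (Fin d → ℝ) =>
      hatAlg d n k r p.2.1 (fun y => sgn (g y - p.1)) p.2.2 := by
  unfold hatAlg linAlg
  fun_prop

lemma intervalIntegrable_hatAlg_threshold {d n k r : ℕ} (ξ : Fin n → (Fin d → ℝ))
    (f : (Fin d → ℝ) → ℝ) (x : Fin d → ℝ) (a b : ℝ) :
    IntervalIntegrable (fun t => hatAlg d n k r ξ (fun y => sgn (f y - t)) x) volume a b := by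
  have hm : Measurable fun t : ℝ => hatAlg d n k r ξ (fun y => sgn (f y - t)) x := by
    unfold hatAlg linAlg
    fun_prop
  exact (intervalIntegrable_const (c := (1 : ℝ))).mono_fun hm.aestronglyMeasurable
    (.of_forall fun t => by simpa [hatAlg] using abs_sgn_le_one _)

lemma intervalIntegrable_sgn_sub (a b c : ℝ) :
    IntervalIntegrable (fun t => sgn (a - t)) volume b c := by
  have hm : Measurable fun t : ℝ => sgn (a - t) := by fun_prop
  exact (intervalIntegrable_const (c := (1 : ℝ))).mono_fun hm.aestronglyMeasurable
    (.of_forall fun t => by simpa using abs_sgn_le_one _)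

/-- The layer-cake formula for the threshold functions `sgn (· - t)`. -/
lemma integral_sgn_sub {a : ℝ} (ha : a ∈ Set.Icc (-1 : ℝ) 1) :
    ∫ t in (-1 : ℝ)..1, sgn (a - t) = 2 * a := by
  rw [← intervalIntegral.integral_add_adjacent_intervals
    (intervalIntegrable_sgn_sub a (-1) a) (intervalIntegrable_sgn_sub a a 1)]
  have h₁ : ∫ t in (-1 : ℝ)..a, sgn (a - t) = ∫ _ in (-1 : ℝ)..a, (1 : ℝ) := by
    rw [intervalIntegral.integral_of_le ha.1, intervalIntegral.integral_of_le ha.1]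
    refine setIntegral_congr_fun measurableSet_Ioc fun t ht => ?_
    simp [sgn, ht.2]
  have h₂ : ∫ t in a..1, sgn (a - t) = ∫ _ in a..1, (-1 : ℝ) := by
    rw [intervalIntegral.integral_of_le ha.2, intervalIntegral.integral_of_le ha.2]
    refine setIntegral_congr_fun measurableSet_Ioc fun t ht => ?_
    simp [sgn, ht.1]
  rw [h₁, h₂]
  simp only [intervalIntegral.integral_const, smul_eq_mul]
  ring

lemma ofReal_abs_barAlg_sub_le {d n k r : ℕ} (ξ : Fin n → (Fin d → ℝ))
    {f : (Fin d → ℝ) → ℝ} {x : Fin d → ℝ} (hx : f x ∈ Set.Icc (-1 : ℝ) 1) :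
    ENNReal.ofReal |barAlg d n k r ξ f x - f x| ≤
      2⁻¹ * ∫⁻ t in Set.Ioc (-1 : ℝ) 1,
        ENNReal.ofReal |hatAlg d n k r ξ (fun y => sgn (f y - t)) x - sgn (f x - t)| := by
  have h : barAlg d n k r ξ f x - f x = 2⁻¹ * ∫ t in Set.Ioc (-1 : ℝ) 1,
      (hatAlg d n k r ξ (fun y => sgn (f y - t)) x - sgn (f x - t)) := by
    rw [← intervalIntegral.integral_of_le (by norm_num), intervalIntegral.integral_sub
      (intervalIntegrable_hatAlg_threshold ξ f x _ _) (intervalIntegrable_sgn_sub _ _ _),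
      integral_sgn_sub hx, barAlg]
    ring
  rw [h, abs_mul, ENNReal.ofReal_mul (abs_nonneg _)]
  have h2 : ENNReal.ofReal |(2⁻¹ : ℝ)| = 2⁻¹ := by
    rw [abs_of_pos (by norm_num), ENNReal.ofReal_inv_of_pos (by norm_num), ENNReal.ofReal_ofNat]
  rw [h2]
  gcongr
  simpa only [Real.enorm_eq_ofReal_abs] using enorm_integral_le_lintegral_enorm
    (μ := volume.restrict (Set.Ioc (-1 : ℝ) 1))
    (fun t => hatAlg d n k r ξ (fun y => sgn (f y - t)) x - sgn (f x - t))

lemma sgn_sub_eq_self {a t : ℝ} (ha : a = -1 ∨ a = 1) (ht : t ∈ Set.Ioc (-1 : ℝ) 1) :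
    sgn (a - t) = a := by
  obtain ⟨h₁, h₂⟩ := ht
  rcases ha with rfl | rfl
  · rw [sgn, if_neg (by linarith)]
  · rw [sgn, if_pos (by linarith)]

/-- On sign-valued functions sampled in the cube, the two methods coincide. -/
lemma barAlg_eq_hatAlg {d n k r : ℕ} {ξ : Fin n → (Fin d → ℝ)} {f : (Fin d → ℝ) → ℝ}
    (h : ∀ i, f (ξ i) = -1 ∨ f (ξ i) = 1) : barAlg d n k r ξ f = hatAlg d n k r ξ f := by
  funext x
  have hI : ∫ t in (-1 : ℝ)..1, hatAlg d n k r ξ (fun y => sgn (f y - t)) x =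
      ∫ _ in (-1 : ℝ)..1, hatAlg d n k r ξ f x := by
    rw [intervalIntegral.integral_of_le (by norm_num),
      intervalIntegral.integral_of_le (by norm_num)]
    refine setIntegral_congr_fun measurableSet_Ioc fun t ht => ?_
    exact congrFun (hatAlg_congr fun i => sgn_sub_eq_self (h i) ht) x
  rw [barAlg, hI, intervalIntegral.integral_const, smul_eq_mul]
  ring

lemma monotone_sgn : Monotone sgn := by
  intro s t hst
  unfold sgn
  split_ifs <;> linarith

lemma sgn_sub_mem_FMonPM {d : ℕ} {f : (Fin d → ℝ) → ℝ} (hf : f ∈ FMon d) (t : ℝ) :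
    (fun y => sgn (f y - t)) ∈ FMonPM d := by
  refine ⟨⟨fun x _ => abs_le.1 (abs_sgn_le_one _), fun x hx y hy hxy => ?_⟩, fun x _ => ?_⟩
  · exact monotone_sgn (sub_le_sub_right (hf.2 x hx y hy hxy) t)
  · dsimp only [sgn]
    split_ifs <;> simp

/-- Coordinatewise monotone functions on the cube are Lebesgue measurable. -/
lemma aemeasurable_of_mem_FMon {d : ℕ} {f : (Fin d → ℝ) → ℝ} (hf : f ∈ FMon d) :
    AEMeasurable f (volume.restrict (unitCube d)) := by
  refine NullMeasurable.aemeasurable ?_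
  have key : ∀ c, NullMeasurableSet (f ⁻¹' Set.Ici c) (volume.restrict (unitCube d)) := by
    intro c
    let U : Set (Fin d → ℝ) := {y | ∃ x ∈ unitCube d, c ≤ f x ∧ x ≤ y}
    have hU : IsUpperSet U := fun a b hab ⟨x, hx, hc, hxa⟩ => ⟨x, hx, hc, hxa.trans hab⟩
    have hUm : NullMeasurableSet U (volume.restrict (unitCube d)) :=
      hU.ordConnected.nullMeasurableSet.mono_ac Measure.restrict_le_self.absolutelyContinuous
    refine hUm.congr ?_
    filter_upwards [ae_restrict_mem (measurableSet_unitCube d)] with y hy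
    refine propext ⟨fun ⟨x, hx, hc, hxy⟩ => hc.trans (hf.2 x hx y hy hxy), fun h => ?_⟩
    exact ⟨y, hy, h, le_rfl⟩
  exact measurable_of_Ici (δ := NullMeasurableSpace _ (volume.restrict (unitCube d))) key

instance isFiniteMeasure_restrict_unitCube (d : ℕ) :
    IsFiniteMeasure ((volume : Measure (Fin d → ℝ)).restrict (unitCube d)) :=
  ⟨by simpa [unitCube] using (isCompact_Icc (a := (0 : Fin d → ℝ)) (b := 1)).measure_lt_top⟩

instance sigmaFinite_sampleMeasure (d n : ℕ) : SigmaFinite (sampleMeasure d n) := by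
  unfold sampleMeasure
  infer_instance

/-- A property holding almost everywhere on the cube holds almost surely at all samples. -/
lemma ae_sampleMeasure {d n : ℕ} {p : (Fin d → ℝ) → Prop}
    (h : ∀ᵐ x ∂volume.restrict (unitCube d), p x) :
    ∀ᵐ ξ ∂sampleMeasure d n, ∀ i, p (ξ i) :=
  ae_all_iff.2 fun _ => Measure.tendsto_eval_ae_ae h

lemma lintegral_dist1e_barAlg_le {d n k r : ℕ} {f : (Fin d → ℝ) → ℝ} (hf : f ∈ FMon d)
    {S : ℝ≥0∞}
    (hS : ∀ t, ∫⁻ ξ, dist1e (hatAlg d n k r ξ fun y => sgn (f y - t)) (fun y => sgn (f y - t))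
      ∂sampleMeasure d n ≤ S) :
    ∫⁻ ξ, dist1e (barAlg d n k r ξ f) f ∂sampleMeasure d n ≤ S := by
  obtain ⟨g, hg, hfg⟩ := aemeasurable_of_mem_FMon hf
  let F : ℝ × (Fin n → (Fin d → ℝ)) × (Fin d → ℝ) → ℝ≥0∞ := fun p =>
    ENNReal.ofReal |hatAlg d n k r p.2.1 (fun y => sgn (g y - p.1)) p.2.2 - sgn (g p.2.2 - p.1)|
  have hF : Measurable F := by
    have := measurable_hatAlg_threshold d n k r hg
    fun_prop
  have hξ := ae_sampleMeasure (n := n) hfg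
  have hFt : ∀ t, ∫⁻ ξ, (∫⁻ x in unitCube d, F (t, ξ, x)) ∂sampleMeasure d n ≤ S := by
    intro t
    refine le_trans (le_of_eq (lintegral_congr_ae ?_)) (hS t)
    filter_upwards [hξ] with ξ hξ
    refine lintegral_congr_ae ?_
    filter_upwards [hfg] with x hx
    simp only [F, hx]
    rw [hatAlg_congr (f := fun y => sgn (f y - t)) (g := fun y => sgn (g y - t))
      fun i => by simp only [hξ i]]
  calc ∫⁻ ξ, dist1e (barAlg d n k r ξ f) f ∂sampleMeasure d n
      ≤ ∫⁻ ξ, (∫⁻ x in unitCube d, 2⁻¹ * ∫⁻ t in Set.Ioc (-1 : ℝ) 1, F (t, ξ, x))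
          ∂sampleMeasure d n := by
        refine lintegral_mono_ae ?_
        filter_upwards [hξ] with ξ hξ
        refine lintegral_mono_ae ?_
        filter_upwards [hfg, ae_restrict_mem (measurableSet_unitCube d)] with x hx hxc
        refine (ofReal_abs_barAlg_sub_le ξ (hf.1 x hxc)).trans (le_of_eq ?_)
        congr 1
        refine lintegral_congr fun t => ?_
        simp only [F, hx]
        rw [hatAlg_congr (f := fun y => sgn (f y - t)) (g := fun y => sgn (g y - t))
          fun i => by simp only [hξ i]]
    _ = 2⁻¹ * ∫⁻ ξ, (∫⁻ t in Set.Ioc (-1 : ℝ) 1, ∫⁻ x in unitCube d, F (t, ξ, x))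
          ∂sampleMeasure d n := by
        rw [← lintegral_const_mul' _ _ (by simp)]
        refine lintegral_congr fun ξ => ?_
        rw [lintegral_const_mul' _ _ (by simp), lintegral_lintegral_swap]
        exact Measurable.aemeasurable (by unfold Function.uncurry; fun_prop)
    _ = 2⁻¹ * ∫⁻ t in Set.Ioc (-1 : ℝ) 1, ∫⁻ ξ, (∫⁻ x in unitCube d, F (t, ξ, x))
          ∂sampleMeasure d n := by
        rw [lintegral_lintegral_swap]
        refine Measurable.aemeasurable ?_
        exact Measurable.lintegral_prod_right'
          (f := fun p : ((Fin n → (Fin d → ℝ)) × ℝ) × (Fin d → ℝ) => F (p.1.2, p.1.1, p.2))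
          (by fun_prop)
    _ ≤ 2⁻¹ * ∫⁻ _ in Set.Ioc (-1 : ℝ) 1, S := by
        gcongr with t
        exact hFt t
    _ = S := by
        have h2 : ENNReal.ofReal (1 - -1) = 2 := by norm_num
        rw [setLIntegral_const, Real.volume_Ioc, h2, mul_comm S, ← mul_assoc,
          ENNReal.inv_mul_cancel (by simp) (by simp), one_mul]

/-- The methods `Â_{n,k,r}` on the sign-valued class and `Ā_{n,k,r}` on the
full monotone class have equal worst-case expected `L₁`-errors (expectation over the `n`
i.i.d. uniform sample points). -/
theorem statement5 (d n k r : ℕ) :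
    (⨆ f : FMonPM d, ∫⁻ ξ, dist1e (hatAlg d n k r ξ f.1) f.1 ∂sampleMeasure d n)
      = ⨆ f : FMon d, ∫⁻ ξ, dist1e (barAlg d n k r ξ f.1) f.1 ∂sampleMeasure d n := by
  refine le_antisymm (iSup_le fun f => ?_) (iSup_le fun f => ?_)
  · refine le_trans (le_of_eq (lintegral_congr_ae ?_))
      (le_iSup (fun f : FMon d => ∫⁻ ξ, dist1e (barAlg d n k r ξ f.1) f.1 ∂sampleMeasure d n)
        ⟨f.1, f.2.1⟩)
    filter_upwards [ae_sampleMeasure (ae_restrict_mem (measurableSet_unitCube d))] with ξ hξ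
    simp only [barAlg_eq_hatAlg fun i => f.2.2 (ξ i) (hξ i)]
  · exact lintegral_dist1e_barAlg_le f.2 fun t =>
      le_iSup (fun f : FMonPM d => ∫⁻ ξ, dist1e (hatAlg d n k r ξ f.1) f.1 ∂sampleMeasure d n)
        ⟨_, sgn_sub_mem_FMonPM f.2 t⟩

end
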